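/- Let k be a field of characteristic 0 and Ω a set. Let (A, ρ_Ω, 𝔞_Ω) be an Ω-matching twisted Rota-Baxter algebra of weight 0: a commutative k-algebra A with k-linear maps ρ_ω : A → A and units 𝔞_ω ∈ A^× satisfying ρ_α(x)ρ_β(y) = 𝔞_α ρ_β(𝔞_α⁻¹ρ_α(x)y) + 𝔞_β ρ_α(𝔞_β⁻¹xρ_β(y)) for all x, y ∈ A, α, β ∈ Ω. Define ρ̌_ω(a) := 𝔞_ω⁻¹·ρ_ω(𝔞_ω·a). Let B be a commutative k-algebra. Suppose F is a commutative k-algebra with k-linear maps P_ω : F → F making (F, P_Ω) an Ω-matching Rota-Baxter algebra of weight 0, together with a k-algebra homomorphism j : A → F satisfying j ∘ ρ̌_ω = P_ω ∘ j for all ω, and a k-algebra homomorphism i : B → F, such that the following universal property holds: for every commutative k-algebra R with k-linear maps Q_ω making (R, Q_Ω) an Ω-matching Rota-Baxter algebra of weight 0, every k-algebra homomorphism j_R : A → R with j_R ∘ ρ̌_ω = Q_ω ∘ j_R for all ω, and every k-algebra homomorphism f : B → R, there exists a unique k-algebra homomorphism φ : F → R with φ ∘ P_ω = Q_ω ∘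 φ for all ω, φ ∘ j = j_R, and φ ∘ i = f. Set 𝔞_{F,ω} := j(𝔞_ω) (a unit of F) and P^𝔞_ω(u) := 𝔞_{F,ω}·P_ω(𝔞_{F,ω}⁻¹·u). Then: (F, P^𝔞_Ω, 𝔞_{F,Ω}) is an Ω-matching twisted Rota-Baxter algebra of weight 0 with twist 𝔞_{F,Ω}, j satisfies j ∘ ρ_ω = P^𝔞_ω ∘ j for all ω, and the analogous universal property holds: for every Ω-matching twisted Rota-Baxter algebra (R, Q_Ω, b_Ω) of weight 0, every k-algebra homomorphism j_R : A → R with j_R(𝔞_ω) = b_ω and j_R ∘ ρ_ω = Q_ω ∘ j_R for all ω, and every k-algebra homomorphism f : B → R, there exists a unique k-algebra homomorphism φ : F → R with φ ∘ P^𝔞_ω = Q_ω ∘ φ for all ω, φ ∘ j = j_R, and φ ∘ i = f. -/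

import Mathlib

/-- The conjugated operator `ρ̌(r) := 𝔞⁻¹ · ρ(𝔞 · r)` of a linear operator `ρ` by a
unit `𝔞`. -/
def conjOp {k R : Type*} [CommSemiring k] [CommRing R] [Algebra k R]
    (P : R →ₗ[k] R) (a : Rˣ) : R → R :=
  fun r => (↑a⁻¹ : R) * P ((a : R) * r)

/-- The twisted operator `P^𝔞(u) := 𝔞·P(𝔞⁻¹·u)` of a linear operator `P` by a unit `𝔞`. -/
def twistOp {k R : Type*} [CommSemiring k] [CommRing R] [Algebra k R]
    (P : R →ₗ[k] R) (a : Rˣ) : R → R :=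
  fun u => (a : R) * P ((↑a⁻¹ : R) * u)

/-- The conjugated operator `conjOp P a` as a linear map. -/
def conjLinearMap {k R : Type*} [CommSemiring k] [CommRing R] [Algebra k R]
    (P : R →ₗ[k] R) (a : Rˣ) : R →ₗ[k] R :=
  LinearMap.mulLeft k (↑a⁻¹ : R) ∘ₗ P ∘ₗ LinearMap.mulLeft k (a : R)

theorem conjLinearMap_apply {k R : Type*} [CommSemiring k] [CommRing R] [Algebra k R]
    (P : R →ₗ[k] R) (a : Rˣ) (x : R) : conjLinearMap P a x = ↑a⁻¹ * P (a * x) := rfl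

/-- Twisting by units turns the matching Rota-Baxter identity into the twisted one. -/
theorem twistOp_mul_twistOp {k R : Type*} [CommSemiring k] [CommRing R] [Algebra k R]
    {P Q : R →ₗ[k] R} (a b : Rˣ)
    (h : ∀ x y, P x * Q y = P (x * Q y) + Q (P x * y)) (x y : R) :
    twistOp P a x * twistOp Q b y =
      a * twistOp Q b (↑a⁻¹ * twistOp P a x * y) +
        b * twistOp P a (↑b⁻¹ * x * twistOp Q b y) := by
  have h₁ : (↑b⁻¹ : R) * (↑a⁻¹ * (a * P (↑a⁻¹ * x)) * y) = P (↑a⁻¹ * x) * (↑b⁻¹ * y) := by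
    rw [Units.inv_mul_cancel_left]; ring
  have h₂ : (↑a⁻¹ : R) * (↑b⁻¹ * x * (b * Q (↑b⁻¹ * y))) = ↑a⁻¹ * x * Q (↑b⁻¹ * y) := by
    rw [mul_mul_mul_comm (↑b⁻¹ : R), Units.inv_mul, one_mul, mul_assoc]
  simp only [twistOp, h₁, h₂]
  linear_combination (a * b : R) * h (↑a⁻¹ * x) (↑b⁻¹ * y)

/-- Conjugating by units turns the twisted matching Rota-Baxter identity into the untwisted
one. -/
theorem conjLinearMap_mul_conjLinearMap {k R : Type*} [CommSemiring k] [CommRing R]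
    [Algebra k R] {P Q : R →ₗ[k] R} (a b : Rˣ)
    (h : ∀ x y, P x * Q y = a * Q (↑a⁻¹ * P x * y) + b * P (↑b⁻¹ * x * Q y)) (x y : R) :
    conjLinearMap P a x * conjLinearMap Q b y =
      conjLinearMap P a (x * conjLinearMap Q b y) +
        conjLinearMap Q b (conjLinearMap P a x * y) := by
  have h₁ : (b : R) * (↑a⁻¹ * P (a * x) * y) = ↑a⁻¹ * P (a * x) * (b * y) := by ring
  have h₂ : (a : R) * (x * (↑b⁻¹ * Q (b * y))) = ↑b⁻¹ * (a * x) * Q (b * y) := by ring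
  simp only [conjLinearMap_apply, h₁, h₂]
  linear_combination (↑a⁻¹ * ↑b⁻¹ : R) * h (a * x) (b * y) +
    ↑b⁻¹ * Q (↑a⁻¹ * P (a * x) * (b * y)) * a.inv_mul +
    ↑a⁻¹ * P (↑b⁻¹ * (a * x) * Q (b * y)) * b.inv_mul

/-- Intertwining `twistOp P c` with `Q` amounts to intertwining `P` with the conjugate of `Q`
by the image of `c`. -/
theorem map_twistOp_iff {k F R : Type*} [CommSemiring k] [CommRing F] [Algebra k F]
    [CommRing R] [Algebra k R] (φ : F →ₐ[k] R) (P : F →ₗ[k] F) (Q : R →ₗ[k] R)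
    {c : Fˣ} {b : Rˣ} (h : φ c = b) :
    (∀ u, φ (twistOp P c u) = Q (φ u)) ↔ ∀ u, φ (P u) = conjLinearMap Q b (φ u) := by
  have h_inv : φ (↑c⁻¹ : F) = ↑b⁻¹ := by
    rw [← b.mul_right_inj, ← h, ← map_mul, c.mul_inv, map_one, h, b.mul_inv]
  simp only [conjLinearMap_apply, twistOp, map_mul, h]
  refine ⟨fun H u => ?_, fun H u => ?_⟩
  · have := H (c * u)
    rw [Units.inv_mul_cancel_left, map_mul, h] at this
    rw [← this, Units.inv_mul_cancel_left]
  · rw [H, map_mul φ, h_inv, Units.mul_inv_cancel_left, Units.mul_inv_cancel_left]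

/-- Let `(A, ρ_Ω, 𝔞_Ω)` be an `Ω`-matching twisted Rota-Baxter algebra of
weight 0 over a field `k` of characteristic 0, and let `B` be a commutative `k`-algebra.
If `(F, P_Ω, j, i)` is the free `(A, ρ̌_Ω)`-matching Rota-Baxter algebra of weight 0 over
`B` (i.e. it satisfies the universal property among matching Rota-Baxter algebras relative
to `(A, ρ̌_Ω)`, where `ρ̌_ω(a) = 𝔞_ω⁻¹ρ_ω(𝔞_ω a)`), then with `𝔞_{F,ω} := j(𝔞_ω)` and
`P^𝔞_ω(u) := 𝔞_{F,ω}·P_ω(𝔞_{F,ω}⁻¹·u)`, the triple `(F, P^𝔞_Ω, 𝔞_{F,Ω})` is an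
`Ω`-matching twisted Rota-Baxter algebra of weight 0, `j` intertwines `ρ_ω` with `P^𝔞_ω`,
and `(F, P^𝔞_Ω, 𝔞_{F,Ω}, j, i)` is the free `(A, ρ_Ω, 𝔞_Ω)`-matching twisted Rota-Baxter
algebra of weight 0 over `B`. -/
theorem free_relative_mtrba.{u, v}
    (k : Type*) [Field k] [CharZero k] (Ω : Type*)
    (A : Type u) [CommRing A] [Algebra k A]
    (ρ : Ω → A →ₗ[k] A) (a : Ω → Aˣ)
    (hA : ∀ (α β : Ω) (x y : A),
      ρ α x * ρ β y =
        (a α : A) * ρ β ((↑(a α)⁻¹ : A) * ρ α x * y) +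
          (a β : A) * ρ α ((↑(a β)⁻¹ : A) * x * ρ β y))
    (B : Type u) [CommRing B] [Algebra k B]
    (F : Type u) [CommRing F] [Algebra k F]
    (P : Ω → F →ₗ[k] F)
    (hF : ∀ (α β : Ω) (x y : F),
      P α x * P β y = P α (x * P β y) + P β (P α x * y))
    (j : A →ₐ[k] F)
    (hj : ∀ (ω : Ω) (x : A), j (conjOp (ρ ω) (a ω) x) = P ω (j x))
    (i : B →ₐ[k] F)
    (huniv : ∀ (R : Type v) [CommRing R] [Algebra k R],
      ∀ (Q : Ω → R →ₗ[k] R),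
        (∀ (α β : Ω) (x y : R),
          Q α x * Q β y = Q α (x * Q β y) + Q β (Q α x * y)) →
        ∀ (jR : A →ₐ[k] R),
          (∀ (ω : Ω) (x : A), jR (conjOp (ρ ω) (a ω) x) = Q ω (jR x)) →
          ∀ (f : B →ₐ[k] R),
            ∃! φ : F →ₐ[k] R,
              (∀ (ω : Ω) (u : F), φ (P ω u) = Q ω (φ u)) ∧
                φ.comp j = jR ∧ φ.comp i = f) :
    -- (1) `(F, P^𝔞_Ω, j(𝔞_Ω))` is an Ω-matching twisted Rota-Baxter algebra of weight 0:
    (∀ (α β : Ω) (x y : F),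
      twistOp (P α) (Units.map j.toMonoidHom (a α)) x *
          twistOp (P β) (Units.map j.toMonoidHom (a β)) y =
        j (a α) *
            twistOp (P β) (Units.map j.toMonoidHom (a β))
              (j (↑(a α)⁻¹ : A) * twistOp (P α) (Units.map j.toMonoidHom (a α)) x * y) +
          j (a β) *
            twistOp (P α) (Units.map j.toMonoidHom (a α))
              (j (↑(a β)⁻¹ : A) * x * twistOp (P β) (Units.map j.toMonoidHom (a β)) y))
    ∧
    -- (2) `j` intertwines `ρ_ω` with `P^𝔞_ω`:
    (∀ (ω : Ω) (x : A),
      j (ρ ω x) = twistOp (P ω) (Units.map j.toMonoidHom (a ω)) (j x))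
    ∧
    -- (3) the universal property for matching twisted Rota-Baxter algebras of weight 0:
    (∀ (R : Type v) [CommRing R] [Algebra k R],
      ∀ (Q : Ω → R →ₗ[k] R) (b : Ω → Rˣ),
        (∀ (α β : Ω) (x y : R),
          Q α x * Q β y =
            (b α : R) * Q β ((↑(b α)⁻¹ : R) * Q α x * y) +
              (b β : R) * Q α ((↑(b β)⁻¹ : R) * x * Q β y)) →
        ∀ (jR : A →ₐ[k] R),
          (∀ ω : Ω, jR (a ω) = (b ω : R)) →
          (∀ (ω : Ω) (x : A), jR (ρ ω x) = Q ω (jR x)) →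
          ∀ (f : B →ₐ[k] R),
            ∃! φ : F →ₐ[k] R,
              (∀ (ω : Ω) (u : F),
                φ (twistOp (P ω) (Units.map j.toMonoidHom (a ω)) u) = Q ω (φ u)) ∧
                φ.comp j = jR ∧ φ.comp i = f) := by
  have h_inv : ∀ ω, j (↑(a ω)⁻¹ : A) = ↑(Units.map j.toMonoidHom (a ω))⁻¹ := fun ω => rfl
  refine ⟨fun α β x y => ?_, fun ω x => ?_, fun R _ _ Q b hQ jR hb hjR f => ?_⟩
  · rw [h_inv, h_inv]
    exact twistOp_mul_twistOp _ _ (hF α β) x y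
  · have h : (↑(Units.map j.toMonoidHom (a ω))⁻¹ : F) * j x = j (↑(a ω)⁻¹ * x) := by
      rw [map_mul, h_inv]
    rw [twistOp, h, ← hj, conjOp, Units.mul_inv_cancel_left, map_mul, h_inv]
    exact (Units.mul_inv_cancel_left (Units.map j.toMonoidHom (a ω)) _).symm
  · have h_unit : ∀ φ : F →ₐ[k] R, φ.comp j = jR →
        ∀ ω, φ (Units.map j.toMonoidHom (a ω) : Fˣ) = b ω := fun φ h ω =>
      (DFunLike.congr_fun h (a ω : A)).trans (hb ω)
    have h_intertwine : ∀ ω x,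
        jR (conjOp (ρ ω) (a ω) x) = conjLinearMap (Q ω) (b ω) (jR x) := fun ω => by
      refine (map_twistOp_iff jR (conjLinearMap (ρ ω) (a ω)) (Q ω) (hb ω)).1 fun x => ?_
      rw [twistOp, conjLinearMap_apply, Units.mul_inv_cancel_left, Units.mul_inv_cancel_left,
        hjR]
    refine (existsUnique_congr fun φ => ?_).2 (huniv R (fun ω => conjLinearMap (Q ω) (b ω))
      (fun α β => conjLinearMap_mul_conjLinearMap _ _ (hQ α β)) jR h_intertwine f)
    exact and_congr_left fun h => forall_congr' fun ω =>
      map_twistOp_iff φ (P ω) (Q ω) (h_unit φ h.1 ω)
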